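/- Let q be a prime power with characteristic p, n ≥ 1, and let σ be the F_q-automorphism of F_q(X) with σ(X) = X + 1. Then Fix(σ) = q^{2n/p - 1} if p divides n; Fix(σ) = 1 if n = 1; Fix(σ) = q^{2(n-1)/p - 1}(q - 1) if n ≡ 1 (mod p) and n > 1; and Fix(σ) = 0 otherwise. -/

import Mathlib

open Polynomial

section Counting

variable {F : Type*} [Field F]

/-- Coprime pairs `(a, b)` with `a` monic of degree `k` and `deg b < k`. -/
def properPairs (F : Type*) [Field F] (k : ℕ) : Set (F[X] × F[X]) :=
  {x | x.1.Monic ∧ x.1.natDegree = k ∧ x.2.degree < x.1.degree ∧ IsCoprime x.1 x.2}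

/-- Coprime pairs `(a, b)` of monic polynomials with `deg b < deg a = n`. -/
def monicPairs (F : Type*) [Field F] (n : ℕ) : Set (F[X] × F[X]) :=
  {x | x ∈ properPairs F n ∧ x.2.Monic}

/-- Coprime pairs `(a, b)` with `b` monic of degree `d` and `deg a ≤ d`. -/
def integralPairs (F : Type*) [Field F] (d : ℕ) : Set (F[X] × F[X]) :=
  {x | x.2.Monic ∧ x.2.natDegree = d ∧ x.1.degree ≤ x.2.degree ∧ IsCoprime x.1 x.2}

theorem card_monic_natDegree_eq (d : ℕ) :
    Nat.card {Q : F[X] // Q.Monic ∧ Q.natDegree = d} = Nat.card F ^ d := by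
  rw [Nat.card_congr ((monicEquivDegreeLT d).trans (degreeLTEquiv F d).toEquiv), Nat.card_fun,
    Nat.card_fin]

theorem finite_setOf_degree_lt [Finite F] (k : ℕ) : {f : F[X] | f.degree < k}.Finite := by
  have : Finite (degreeLT F k) := Finite.of_equiv _ (degreeLTEquiv F k).symm.toEquiv
  refine (Set.toFinite (degreeLT F k : Set F[X])).subset fun f hf => ?_
  exact mem_degreeLT.2 hf

instance finite_properPairs [Finite F] (k : ℕ) : Finite (properPairs F k) := by
  refine Set.Finite.subset ((finite_setOf_degree_lt (F := F) (k + 1)).prod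
    (finite_setOf_degree_lt (F := F) (k + 1))) ?_
  rintro ⟨a, b⟩ ⟨ha, hk, hab, -⟩
  have h : a.degree < ((k + 1 : ℕ) : WithBot ℕ) := by
    rw [degree_eq_natDegree ha.ne_zero]
    exact_mod_cast (show a.natDegree < k + 1 by dsimp at hk; omega)
  exact ⟨h, hab.trans h⟩

theorem card_properPairs_zero : Nat.card (properPairs F 0) = 1 := by
  rw [Nat.card_eq_one_iff_exists]
  refine ⟨⟨(1, 0), monic_one, natDegree_one, by simp, isCoprime_one_left⟩, ?_⟩
  rintro ⟨⟨a, b⟩, ha, hk, hab, -⟩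
  have ha1 : a = 1 := ha.natDegree_eq_zero.1 hk
  have hb : b = 0 := by
    rw [ha1, degree_one] at hab
    exact degree_eq_bot.1 (Nat.WithBot.lt_zero_iff.1 hab)
  subst ha1 hb
  rfl

theorem card_properPairs {k : ℕ} (hk : 1 ≤ k) :
    Nat.card (properPairs F k) = (Nat.card F - 1) * Nat.card (monicPairs F k) := by
  rw [← Nat.card_units, ← Nat.card_prod]
  symm
  let φ : Fˣ × monicPairs F k → properPairs F k := fun x =>
    ⟨(x.2.1.1, C (x.1 : F) * x.2.1.2), x.2.2.1.1, x.2.2.1.2.1, by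
      simpa only [degree_C_mul x.1.ne_zero] using x.2.2.1.2.2.1,
      (isCoprime_mul_unit_left_right (x.1.isUnit.map C) _ _).2 x.2.2.1.2.2.2⟩
  refine Nat.card_eq_of_bijective φ ⟨?_, ?_⟩
  · rintro ⟨e, ⟨⟨a, b⟩, h, hb⟩⟩ ⟨e', ⟨⟨a', b'⟩, h', hb'⟩⟩ heq
    obtain rfl : a = a' := congrArg (fun x => x.1.1) heq
    replace heq : C (e : F) * b = C (e' : F) * b' := congrArg (fun x => x.1.2) heq
    have he : e = e' := by
      have := congrArg leadingCoeff heq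
      dsimp only at hb hb'
      rw [leadingCoeff_mul, leadingCoeff_mul, hb, hb'] at this
      exact Units.ext (by simpa using this)
    subst he
    have : b = b' := mul_left_cancel₀ (C_ne_zero.2 e.ne_zero) heq
    subst this
    rfl
  · rintro ⟨⟨a, b⟩, ha, hak, hab, hc⟩
    dsimp only at ha hak hab hc
    have hb : b ≠ 0 := by
      rintro rfl
      have := ha.eq_one_of_isUnit (isCoprime_zero_right.1 hc)
      simp [this] at hak
      omega
    have hl := leadingCoeff_ne_zero.2 hb
    refine ⟨(Units.mk0 _ hl, ⟨(a, C b.leadingCoeff⁻¹ * b), ⟨ha, hak, ?_, ?_⟩, ?_⟩), ?_⟩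
    · simpa only [degree_C_mul (inv_ne_zero hl)] using hab
    · exact (isCoprime_mul_unit_left_right ((inv_ne_zero hl).isUnit.map C) _ _).2 hc
    · simp [Monic, hl]
    · simp [φ, ← mul_assoc, ← C_mul, hl]

theorem card_integralPairs (d : ℕ) :
    Nat.card (integralPairs F d) = Nat.card F * Nat.card (properPairs F d) := by
  rw [← Nat.card_prod]
  symm
  let φ : F × properPairs F d → integralPairs F d := fun x =>
    ⟨(x.2.1.2 + x.2.1.1 * C x.1, x.2.1.1), x.2.2.1, x.2.2.2.1,
      (degree_add_le _ _).trans (max_le x.2.2.2.2.1.le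
        ((degree_mul_le _ _).trans (add_le_of_nonpos_right degree_C_le))),
      (IsCoprime.add_mul_left_left_iff).2 x.2.2.2.2.2.symm⟩
  refine Nat.card_eq_of_bijective φ ⟨?_, ?_⟩
  · rintro ⟨c, ⟨⟨b, a⟩, hb, hd, hab, hc⟩⟩ ⟨c', ⟨⟨b', a'⟩, hb', hd', hab', hc'⟩⟩ heq
    obtain rfl : b = b' := congrArg (fun x => x.1.2) heq
    replace heq : a + b * C c = a' + b * C c' := congrArg (fun x => x.1.1) heq
    obtain ⟨h1, h2⟩ := div_modByMonic_unique (f := a + b * C c) (C c) a hb ⟨rfl, hab⟩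
    obtain ⟨h1', h2'⟩ := div_modByMonic_unique (f := a + b * C c) (C c') a' hb ⟨heq.symm, hab'⟩
    obtain rfl := C_injective (h1.symm.trans h1')
    obtain rfl := h2.symm.trans h2'
    rfl
  · rintro ⟨⟨a, b⟩, hb, hd, hab, hc⟩
    dsimp only at hb hd hab hc
    have hQ : a /ₘ b = C ((a /ₘ b).coeff 0) := by
      refine eq_C_of_natDegree_eq_zero ?_
      rw [natDegree_divByMonic a hb]
      have := natDegree_le_natDegree hab
      omega
    have hdiv := modByMonic_add_div a b
    rw [hQ] at hdiv
    refine ⟨((a /ₘ b).coeff 0, ⟨(b, a %ₘ b), hb, hd, degree_modByMonic_lt a hb, ?_⟩), ?_⟩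
    · rw [← hdiv] at hc
      exact (IsCoprime.add_mul_left_left_iff.1 hc).symm
    · simp [φ, hdiv]

theorem card_monicPairs_eq_sum [Finite F] (m : ℕ) :
    Nat.card (monicPairs F m) =
      ∑ k ∈ Finset.range m, Nat.card F ^ (m - k) * Nat.card (properPairs F k) := by
  have hfin : ∀ d, Finite {Q : F[X] // Q.Monic ∧ Q.natDegree = d} := fun d =>
    Nat.finite_of_card_ne_zero (by rw [card_monic_natDegree_eq]; exact pow_ne_zero _ Nat.card_pos.ne')
  have hsum : ∑ k ∈ Finset.range m, Nat.card F ^ (m - k) * Nat.card (properPairs F k) =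
      Nat.card (Σ k : Fin m,
        {Q : F[X] // Q.Monic ∧ Q.natDegree = m - k} × properPairs F k) := by
    rw [Nat.card_sigma, Finset.sum_range]
    simp only [Nat.card_prod, card_monic_natDegree_eq]
  rw [hsum]
  symm
  have hdeg : ∀ {k : ℕ} {Q B r : F[X]}, k < m → Q.Monic → Q.natDegree = m - k → B.Monic →
      B.natDegree = k → r.degree < B.degree →
      r.degree < (B * Q).degree ∧ B.degree < (B * Q).degree ∧ (B * Q).natDegree = m := by
    intro k Q B r hk hQ hQm hB hBk hr
    have h1 : B.degree < (B * Q).degree := by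
      rw [degree_mul, degree_eq_natDegree hB.ne_zero, degree_eq_natDegree hQ.ne_zero]
      exact_mod_cast (by omega : B.natDegree < B.natDegree + Q.natDegree)
    exact ⟨hr.trans h1, h1, by rw [hB.natDegree_mul hQ]; omega⟩
  let φ : (Σ k : Fin m, {Q : F[X] // Q.Monic ∧ Q.natDegree = m - k} × properPairs F k) →
      monicPairs F m := fun x =>
    ⟨(x.2.2.1.2 + x.2.2.1.1 * x.2.1.1, x.2.2.1.1), by
      obtain ⟨k, ⟨Q, hQ, hQm⟩, ⟨⟨B, r⟩, hB, hBk, hr, hc⟩⟩ := x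
      dsimp only at hB hBk hr hc ⊢
      obtain ⟨h1, h2, h3⟩ := hdeg k.2 hQ hQm hB hBk hr
      refine ⟨⟨(hB.mul hQ).add_of_right h1, ?_, ?_, ?_⟩, hB⟩
      · rw [natDegree_add_eq_right_of_degree_lt h1, h3]
      · rwa [degree_add_eq_right_of_degree_lt h1]
      · exact (IsCoprime.add_mul_left_left_iff).2 hc.symm⟩
  refine Nat.card_eq_of_bijective φ ⟨?_, ?_⟩
  · rintro ⟨k, ⟨Q, hQ, hQm⟩, ⟨⟨B, r⟩, hB, hBk, hr, hc⟩⟩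
      ⟨k', ⟨Q', hQ', hQm'⟩, ⟨⟨B', r'⟩, hB', hBk', hr', hc'⟩⟩ heq
    obtain rfl : B = B' := congrArg (fun x => x.1.2) heq
    replace heq : r + B * Q = r' + B * Q' := congrArg (fun x => x.1.1) heq
    obtain rfl : k = k' := Fin.ext (hBk.symm.trans hBk')
    obtain ⟨h1, h2⟩ := div_modByMonic_unique Q r hB ⟨rfl, hr⟩
    obtain ⟨h1', h2'⟩ := div_modByMonic_unique Q' r' hB ⟨heq.symm, hr'⟩
    obtain rfl := h1.symm.trans h1'
    obtain rfl := h2.symm.trans h2'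
    rfl
  · rintro ⟨⟨a, b⟩, ⟨ha, ham, hab, hc⟩, hb⟩
    dsimp only at ha ham hab hc hb
    have hlt : b.natDegree < m := ham ▸ natDegree_lt_natDegree hb.ne_zero hab
    have hdiv := modByMonic_add_div a b
    refine ⟨⟨⟨b.natDegree, hlt⟩, ⟨a /ₘ b, ?_, ?_⟩,
      ⟨(b, a %ₘ b), hb, rfl, degree_modByMonic_lt a hb, ?_⟩⟩, ?_⟩
    · rw [Monic, leadingCoeff_divByMonic_of_monic hb hab.le, ha]
    · rw [natDegree_divByMonic a hb, ham]
    · rw [← hdiv] at hc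
      exact (IsCoprime.add_mul_left_left_iff.1 hc).symm
    · simp [φ, hdiv]

theorem card_monicPairs [Finite F] (m : ℕ) :
    Nat.card (monicPairs F (m + 1)) = Nat.card F ^ (2 * m + 1) := by
  induction m with
  | zero =>
    rw [card_monicPairs_eq_sum, Finset.sum_range_one, card_properPairs_zero]
    simp
  | succ m ih =>
    have hq : 1 ≤ Nat.card F := Nat.card_pos
    have hrec : Nat.card (monicPairs F (m + 1 + 1)) = Nat.card F * Nat.card (monicPairs F (m + 1)) +
        Nat.card F * Nat.card (properPairs F (m + 1)) := by
      rw [card_monicPairs_eq_sum (m + 1 + 1), Finset.sum_range_succ, card_monicPairs_eq_sum (m + 1),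
        Finset.mul_sum]
      congr 1
      · refine Finset.sum_congr rfl fun k hk => ?_
        have := Finset.mem_range.1 hk
        rw [show m + 1 + 1 - k = (m + 1 - k) + 1 by omega, pow_succ]
        ring
      · simp
    rw [hrec, card_properPairs (by omega), ih]
    obtain ⟨r, hr⟩ := Nat.exists_eq_add_of_le hq
    rw [hr, Nat.add_sub_cancel_left]
    ring

end Counting

section Subfields

open IntermediateField

variable {F : Type*} [Field F]

/-- The subfield `F(a / b)` of `F(X)`. -/
noncomputable def quotientField (x : F[X] × F[X]) : IntermediateField F (RatFunc F) :=
  F⟮algebraMap F[X] (RatFunc F) x.1 / algebraMap F[X] (RatFunc F) x.2⟯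

theorem num_denom_of_isCoprime {a b : F[X]} (hb : b.Monic) (h : IsCoprime a b) :
    (algebraMap F[X] (RatFunc F) a / algebraMap F[X] (RatFunc F) b).num = a ∧
      (algebraMap F[X] (RatFunc F) a / algebraMap F[X] (RatFunc F) b).denom = b := by
  set f := algebraMap F[X] (RatFunc F) a / algebraMap F[X] (RatFunc F) b with hf
  have hmul : f.num * b = a * f.denom := (RatFunc.num_mul_eq_mul_denom_iff hb.ne_zero).2 hf
  have h2 : b ∣ f.denom := h.symm.dvd_of_dvd_mul_left (hmul ▸ dvd_mul_left _ _)
  have hd : f.denom = b :=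
    eq_of_monic_of_associated f.monic_denom hb
      (associated_of_dvd_dvd (RatFunc.denom_div_dvd a b) h2)
  rw [hd] at hmul
  exact ⟨mul_right_cancel₀ hb.ne_zero hmul, hd⟩

theorem finrank_quotientField {n : ℕ} {x : F[X] × F[X]} (hx : x ∈ monicPairs F n) :
    Module.finrank (quotientField x) (RatFunc F) = n := by
  obtain ⟨⟨ha, hn, hab, hc⟩, hb⟩ := hx
  obtain ⟨h1, h2⟩ := num_denom_of_isCoprime hb hc
  rw [quotientField, RatFunc.finrank_eq_max_natDegree, h1, h2, hn,
    max_eq_left (hn ▸ natDegree_le_natDegree hab.le)]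

theorem adjoin_simple_eq_of_mem {K L : Type*} [Field K] [Field L] [Algebra K L] {f g : L}
    (h1 : f ∈ K⟮g⟯) (h2 : g ∈ K⟮f⟯) : K⟮f⟯ = K⟮g⟯ :=
  le_antisymm (adjoin_simple_le_iff.2 h1) (adjoin_simple_le_iff.2 h2)

theorem adjoin_simple_mul_algebraMap {K L : Type*} [Field K] [Field L] [Algebra K L] (f : L)
    {c : K} (hc : c ≠ 0) : K⟮f * algebraMap K L c⟯ = K⟮f⟯ := by
  refine adjoin_simple_eq_of_mem
    (mul_mem (mem_adjoin_simple_self K f) (_root_.algebraMap_mem _ c)) ?_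
  have := mul_mem (mem_adjoin_simple_self K (f * algebraMap K L c))
    (_root_.algebraMap_mem K⟮f * algebraMap K L c⟯ c⁻¹)
  rwa [mul_assoc, ← map_mul, mul_inv_cancel₀ hc, map_one, mul_one] at this

theorem adjoin_simple_add_algebraMap {K L : Type*} [Field K] [Field L] [Algebra K L] (f : L)
    (c : K) : K⟮f + algebraMap K L c⟯ = K⟮f⟯ := by
  refine adjoin_simple_eq_of_mem
    (add_mem (mem_adjoin_simple_self K f) (_root_.algebraMap_mem _ c)) ?_
  have := sub_mem (mem_adjoin_simple_self K (f + algebraMap K L c))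
    (_root_.algebraMap_mem K⟮f + algebraMap K L c⟯ c)
  rwa [add_sub_cancel_right] at this

theorem adjoin_simple_inv {K L : Type*} [Field K] [Field L] [Algebra K L] (f : L) :
    K⟮f⁻¹⟯ = K⟮f⟯ := by
  refine adjoin_simple_eq_of_mem (inv_mem (mem_adjoin_simple_self K f)) ?_
  have := inv_mem (mem_adjoin_simple_self K f⁻¹)
  rwa [inv_inv] at this

theorem algebraMap_ratFunc_eq (c : F) :
    algebraMap F (RatFunc F) c = algebraMap F[X] (RatFunc F) (C c) := by
  rw [← Polynomial.algebraMap_eq, ← IsScalarTower.algebraMap_apply]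

theorem exists_degree_lt_of_ne_C (f : RatFunc F) (hf : ¬∃ c, f = RatFunc.C c) :
    ∃ u v : F[X], v ≠ 0 ∧ v.degree < u.degree ∧ IsCoprime u v ∧ quotientField (u, v) = F⟮f⟯ := by
  rcases lt_or_ge f.denom.degree f.num.degree with h | h
  · exact ⟨f.num, f.denom, f.denom_ne_zero, h, f.isCoprime_num_denom, by
      rw [quotientField, f.num_div_denom]⟩
  · set c := f.num.coeff f.denom.natDegree with hc
    have hd := f.denom_ne_zero
    have hd' : algebraMap F[X] (RatFunc F) f.denom ≠ 0 := RatFunc.algebraMap_ne_zero hd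
    have hfc : (algebraMap F[X] (RatFunc F) (f.num + f.denom * C (-c))) /
        algebraMap F[X] (RatFunc F) f.denom = f + algebraMap F (RatFunc F) (-c) := by
      rw [map_add, map_mul, add_div, f.num_div_denom, mul_div_cancel_left₀ _ hd',
        algebraMap_ratFunc_eq]
    refine ⟨f.denom, f.num + f.denom * C (-c), ?_, ?_, ?_, ?_⟩
    · intro h0
      rw [h0, map_zero, zero_div] at hfc
      refine hf ⟨c, ?_⟩
      rw [map_neg, ← sub_eq_add_neg] at hfc
      rw [← RatFunc.algebraMap_eq_C]
      exact (sub_eq_zero.1 hfc.symm)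
    · have hle : (f.num + f.denom * C (-c)).degree ≤ f.denom.natDegree := by
        rw [← degree_eq_natDegree hd]
        exact (degree_add_le _ _).trans (max_le h
          ((degree_mul_le _ _).trans (add_le_of_nonpos_right degree_C_le)))
      rw [degree_eq_natDegree hd]
      refine lt_of_le_of_ne hle fun heq => ?_
      refine coeff_ne_zero_of_eq_degree heq ?_
      simp [← hc, f.monic_denom.coeff_natDegree]
    · exact IsCoprime.symm (IsCoprime.add_mul_left_left_iff.2 f.isCoprime_num_denom)
    · dsimp only [quotientField]
      rw [← inv_div, adjoin_simple_inv, hfc, adjoin_simple_add_algebraMap]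

theorem exists_eq_quotientField {n : ℕ} (hn : 1 ≤ n) (E : IntermediateField F (RatFunc F))
    (hE : Module.finrank E (RatFunc F) = n) : ∃ x ∈ monicPairs F n, quotientField x = E := by
  have hEf := RatFunc.Luroth.eq_adjoin_generator (E := E)
  have hne : ¬∃ c, RatFunc.Luroth.generator E = RatFunc.C c := by
    intro h
    have h0 := (RatFunc.eq_C_iff _).1 h
    rw [hEf, RatFunc.finrank_eq_max_natDegree] at hE
    omega
  obtain ⟨u, v, hv, huv, hcop, hq⟩ := exists_degree_lt_of_ne_C _ hne
  have hu : u ≠ 0 := by rintro rfl; simp at huv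
  have hlu := inv_ne_zero (leadingCoeff_ne_zero.2 hu)
  have hlv := inv_ne_zero (leadingCoeff_ne_zero.2 hv)
  have hfield : quotientField (u * C u.leadingCoeff⁻¹, v * C v.leadingCoeff⁻¹) = E := by
    rw [hEf, ← hq]
    dsimp only [quotientField]
    rw [map_mul, map_mul, mul_div_mul_comm, ← algebraMap_ratFunc_eq, ← algebraMap_ratFunc_eq,
      ← map_div₀ (algebraMap F (RatFunc F)), adjoin_simple_mul_algebraMap _ (div_ne_zero hlu hlv)]
  have hmem : (u * C u.leadingCoeff⁻¹, v * C v.leadingCoeff⁻¹) ∈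
      monicPairs F (u * C u.leadingCoeff⁻¹).natDegree := by
    refine ⟨⟨monic_mul_leadingCoeff_inv hu, rfl, ?_, ?_⟩, monic_mul_leadingCoeff_inv hv⟩
    · simpa only [degree_mul_C hlu, degree_mul_C hlv] using huv
    · exact (isCoprime_mul_unit_right_left (hlu.isUnit.map C) _ _).2
        ((isCoprime_mul_unit_right_right (hlv.isUnit.map C) _ _).2 hcop)
  have hdeg := finrank_quotientField hmem
  rw [hfield, hE] at hdeg
  exact ⟨_, hdeg ▸ hmem, hfield⟩

theorem quotientField_add_mul {a b : F[X]} (hb : b ≠ 0) (β : F) :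
    quotientField (a + C β * b, b) = quotientField (a, b) := by
  dsimp only [quotientField]
  rw [map_add, map_mul, add_div, mul_div_cancel_right₀ _ (RatFunc.algebraMap_ne_zero hb),
    ← algebraMap_ratFunc_eq, adjoin_simple_add_algebraMap]

theorem exists_mobius_of_adjoin_eq {f g : RatFunc F} (hf : ¬∃ c, f = RatFunc.C c)
    (h : F⟮f⟯ = F⟮g⟯) : ∃ r : RatFunc F, max r.num.natDegree r.denom.natDegree = 1 ∧
      aeval f r.denom ≠ 0 ∧ g * aeval f r.denom = aeval f r.num := by
  have htr := RatFunc.transcendental_of_ne_C f hf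
  have hg : g ∈ F⟮f⟯ := h ▸ mem_adjoin_simple_self F g
  set e := RatFunc.algEquivOfTranscendental f htr with he
  set r := e.symm ⟨g, hg⟩ with hr
  have her : ((e r : F⟮f⟯) : RatFunc F) = g := by simp [hr]
  set φ : RatFunc F →ₐ[F] RatFunc F := F⟮f⟯.val.comp e.toAlgHom with hφ
  have hφr : φ r = g := her
  have hφX : φ RatFunc.X = f := by
    change ((e RatFunc.X : F⟮f⟯) : RatFunc F) = f
    rw [he, RatFunc.algEquivOfTranscendental_X]
  have htop : F⟮r⟯ = ⊤ := by
    refine IntermediateField.map_injective φ ?_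
    rw [← RatFunc.adjoin_X, adjoin_map, adjoin_map, Set.image_singleton, Set.image_singleton,
      hφr, hφX, h]
  have hden : aeval f r.denom ≠ 0 := fun h0 =>
    htr ⟨r.denom, r.denom_ne_zero, h0⟩
  refine ⟨r, ?_, hden, ?_⟩
  · rw [← RatFunc.finrank_eq_max_natDegree, htop, IntermediateField.finrank_top]
  · rw [← her, he, RatFunc.algEquivOfTranscendental_apply, div_mul_cancel₀ _ hden]

theorem eq_C_mul_X_add_C_of_max_natDegree_eq_one {r : RatFunc F}
    (h : max r.num.natDegree r.denom.natDegree = 1) :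
    ∃ α β γ δ : F, r.num = C α * X + C β ∧ r.denom = C γ * X + C δ :=
  ⟨_, _, _, _, eq_X_add_C_of_natDegree_le_one ((le_max_left _ _).trans h.le),
    eq_X_add_C_of_natDegree_le_one ((le_max_right _ _).trans h.le)⟩

theorem ne_C_of_mem_monicPairs {n : ℕ} (hn : 1 ≤ n) {a b : F[X]} (h : (a, b) ∈ monicPairs F n) :
    ¬∃ c, algebraMap F[X] (RatFunc F) a / algebraMap F[X] (RatFunc F) b = RatFunc.C c := by
  intro hc
  have h0 := (RatFunc.eq_C_iff _).1 hc
  rw [(num_denom_of_isCoprime h.2 h.1.2.2.2).1] at h0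
  have := h.1.2.1
  dsimp only at this h0
  omega

theorem quotientField_eq_iff {n : ℕ} (hn : 1 ≤ n) {a b c d : F[X]} (hab : (a, b) ∈ monicPairs F n)
    (hcd : (c, d) ∈ monicPairs F n) :
    quotientField (a, b) = quotientField (c, d) ↔ b = d ∧ ∃ β, c = a + C β * b := by
  constructor
  swap
  · rintro ⟨rfl, β, rfl⟩
    exact (quotientField_add_mul hab.2.ne_zero β).symm
  intro h
  obtain ⟨r, hr1, hden, hr⟩ := exists_mobius_of_adjoin_eq (ne_C_of_mem_monicPairs hn hab) h
  obtain ⟨α, β, γ, δ, h1, h2⟩ := eq_C_mul_X_add_C_of_max_natDegree_eq_one hr1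
  obtain ⟨⟨ha, han, hba, hcop⟩, hb⟩ := hab
  obtain ⟨⟨hc, hcn, hdc, hcop'⟩, hd⟩ := hcd
  dsimp only at ha han hba hcop hb hc hcn hdc hcop' hd
  have hb' : algebraMap F[X] (RatFunc F) b ≠ 0 := RatFunc.algebraMap_ne_zero hb.ne_zero
  have hd' : algebraMap F[X] (RatFunc F) d ≠ 0 := RatFunc.algebraMap_ne_zero hd.ne_zero
  have key : c * (C γ * a + C δ * b) = (C α * a + C β * b) * d := by
    apply RatFunc.algebraMap_injective F
    rw [h1, h2] at hr
    simp only [map_add, map_mul, aeval_C, aeval_X, algebraMap_ratFunc_eq] at hr ⊢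
    field_simp at hr
    linear_combination hr
  have hbn : b.natDegree < n := han ▸ natDegree_lt_natDegree hb.ne_zero hba
  have hdn : d.natDegree < n := hcn ▸ natDegree_lt_natDegree hd.ne_zero hdc
  have hγ : γ = 0 := by
    by_contra hγ
    have h3 : (C γ * a + C δ * b).natDegree = n := by
      rw [natDegree_add_eq_left_of_natDegree_lt, natDegree_C_mul hγ, han]
      rw [natDegree_C_mul hγ, han]
      exact (natDegree_C_mul_le _ _).trans_lt hbn
    have h4 : (C α * a + C β * b).natDegree ≤ n :=
      natDegree_add_le_of_degree_le ((natDegree_C_mul_le _ _).trans han.le)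
        ((natDegree_C_mul_le _ _).trans hbn.le)
    have h5 : (c * (C γ * a + C δ * b)).natDegree = n + n := by
      rw [natDegree_mul hc.ne_zero (by rintro h0; rw [h0, natDegree_zero] at h3; omega), hcn, h3]
    rw [key] at h5
    have := natDegree_mul_le (p := C α * a + C β * b) (q := d)
    omega
  subst hγ
  have hδ : δ = 1 := by
    have := r.monic_denom
    rw [h2] at this
    simpa [Monic] using this
  subst hδ
  have hα : α ≠ 0 := by
    rintro rfl
    rw [h1, h2] at hr1
    simp at hr1
  have key' : c * b = (C α * a + C β * b) * d := by simpa using key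
  have hbd : b ∣ d := by
    have h3 : IsCoprime b (C α * a + b * C β) :=
      (IsCoprime.add_mul_left_right_iff).2
        ((isCoprime_mul_unit_left_right (hα.isUnit.map C) _ _).2 hcop.symm)
    rw [mul_comm b] at h3
    exact h3.dvd_of_dvd_mul_left (key' ▸ dvd_mul_left _ _)
  have hdb : d ∣ b := hcop'.symm.dvd_of_dvd_mul_left (key' ▸ dvd_mul_left _ _)
  obtain rfl : b = d := eq_of_monic_of_associated hb hd (associated_of_dvd_dvd hbd hdb)
  have hca : c = C α * a + C β * b := mul_right_cancel₀ hb.ne_zero key'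
  have hα1 : α = 1 := by
    have h3 : (C α * a + C β * b).coeff n = α := by
      rw [coeff_add, coeff_C_mul, coeff_C_mul, coeff_eq_zero_of_natDegree_lt hbn, ← han,
        ha.coeff_natDegree, mul_one, mul_zero, add_zero]
    rw [← h3, ← hca, ← hcn, hc.coeff_natDegree]
  subst hα1
  exact ⟨rfl, β, by simpa using hca⟩

theorem map_quotientField (σ : RatFunc F →ₐ[F] RatFunc F) (s : F[X])
    (hσ : σ RatFunc.X = algebraMap F[X] (RatFunc F) s) (x : F[X] × F[X]) :
    (quotientField x).map σ = quotientField (x.1.comp s, x.2.comp s) := by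
  have hp : ∀ f : F[X], σ (algebraMap F[X] (RatFunc F) f) =
      algebraMap F[X] (RatFunc F) (f.comp s) := by
    intro f
    rw [← RatFunc.aeval_X_left_eq_algebraMap, ← aeval_algHom_apply, hσ,
      aeval_algebraMap_apply]
    rfl
  dsimp only [quotientField]
  rw [adjoin_map, Set.image_singleton, map_div₀, hp, hp]

end Subfields

section Translation

variable {F : Type*} [Field F]

/-- The normalized pairs `(a, b)` for which `X ↦ X + 1` sends `a / b` to `a / b + β`
with `β` constant. -/
def translationPairs (F : Type*) [Field F] (n : ℕ) : Set (F[X] × F[X]) :=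
  {x | x ∈ monicPairs F n ∧ x.2.comp (X + 1) = x.2 ∧ ∃ β, x.1.comp (X + 1) = x.1 + C β * x.2}

theorem degree_comp_X_add_one (f : F[X]) : (f.comp (X + 1)).degree = f.degree := by
  rw [← C_1, ← taylor_apply, degree_taylor]

theorem eq_C_of_comp_X_add_one (p : ℕ) [CharP F p] {f : F[X]} (hf : f.comp (X + 1) = f)
    (hdeg : f.natDegree < p) :
    f = C (f.coeff 0) := by
  classical
  have hroot : ∀ k : ℕ, f.eval (k : F) = f.coeff 0 := by
    intro k
    induction k with
    | zero => rw [coeff_zero_eq_eval_zero, Nat.cast_zero]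
    | succ k ih =>
      rw [← ih]
      conv_rhs => rw [← hf]
      simp
  rw [← sub_eq_zero]
  have hinj : Set.InjOn (fun k : ℕ => (k : F)) (Finset.range p) :=
    (CharP.natCast_injOn_Iio F p).mono fun k hk => by simpa using hk
  refine eq_zero_of_natDegree_lt_card_of_eval_eq_zero' _
    ((Finset.range p).image fun k : ℕ => (k : F)) ?_ ?_
  · intro x hx
    obtain ⟨k, -, rfl⟩ := Finset.mem_image.1 hx
    simp [hroot]
  · rwa [Finset.card_image_of_injOn hinj, Finset.card_range, natDegree_sub_C]

variable (p : ℕ) [Fact p.Prime]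

theorem monic_X_pow_sub_X : (X ^ p - X : F[X]).Monic :=
  monic_X_pow_sub (by rw [degree_X]; exact_mod_cast (Fact.out : p.Prime).one_lt)

theorem natDegree_X_pow_sub_X : (X ^ p - X : F[X]).natDegree = p :=
  FiniteField.X_pow_card_sub_X_natDegree_eq F (Fact.out : p.Prime).one_lt

theorem natDegree_comp_X_pow_sub_X (f : F[X]) :
    (f.comp (X ^ p - X)).natDegree = p * f.natDegree := by
  rw [natDegree_comp, natDegree_X_pow_sub_X, mul_comm]

theorem leadingCoeff_comp_X_pow_sub_X (f : F[X]) :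
    (f.comp (X ^ p - X)).leadingCoeff = f.leadingCoeff := by
  rw [leadingCoeff_comp (by rw [natDegree_X_pow_sub_X]; exact (Fact.out : p.Prime).ne_zero),
    monic_X_pow_sub_X, one_pow, mul_one]

theorem comp_X_pow_sub_X_injective :
    Function.Injective fun f : F[X] => f.comp (X ^ p - X) := by
  intro f g h
  have h0 : (f - g).comp (X ^ p - X) = 0 := by rw [sub_comp]; exact sub_eq_zero.2 h
  rw [← leadingCoeff_eq_zero, leadingCoeff_comp_X_pow_sub_X, leadingCoeff_eq_zero] at h0
  exact sub_eq_zero.1 h0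

theorem isCoprime_comp_X_pow_sub_X {f g : F[X]} :
    IsCoprime (f.comp (X ^ p - X)) (g.comp (X ^ p - X)) ↔ IsCoprime f g := by
  constructor
  · intro h
    rw [← isRelPrime_iff_isCoprime] at h ⊢
    intro d hf hg
    have hd := h (map_dvd (compRingHom (X ^ p - X)) hf) (map_dvd (compRingHom (X ^ p - X)) hg)
    have h0 := natDegree_eq_zero_of_isUnit hd
    rw [coe_compRingHom_apply, natDegree_comp_X_pow_sub_X] at h0
    obtain ⟨c, rfl⟩ :=
      natDegree_eq_zero.1 ((mul_eq_zero.1 h0).resolve_left (Fact.out : p.Prime).ne_zero)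
    rwa [coe_compRingHom_apply, C_comp] at hd
  · exact fun h => h.map (compRingHom (X ^ p - X))

theorem natDegree_comp_mul_C_mul_X {B : F[X]} {β : F} (hB : B.Monic) (hβ : β ≠ 0) :
    (B.comp (X ^ p - X) * (C β * X)).natDegree = p * B.natDegree + 1 := by
  have hB0 : B.comp (X ^ p - X) ≠ 0 := by
    rw [← leadingCoeff_ne_zero, leadingCoeff_comp_X_pow_sub_X, hB]
    exact one_ne_zero
  rw [natDegree_mul hB0 (mul_ne_zero (C_ne_zero.2 hβ) X_ne_zero), natDegree_comp_X_pow_sub_X,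
    natDegree_C_mul hβ, natDegree_X]

theorem leadingCoeff_comp_mul_C_mul_X {B : F[X]} {β : F} (hB : B.Monic) :
    (B.comp (X ^ p - X) * (C β * X)).leadingCoeff = β := by
  rw [leadingCoeff_mul, leadingCoeff_comp_X_pow_sub_X, hB, one_mul, leadingCoeff_mul,
    leadingCoeff_C, leadingCoeff_X, mul_one]

theorem natDegree_comp_mul_C_mul_X_le (B : F[X]) (β : F) :
    (B.comp (X ^ p - X) * (C β * X)).natDegree ≤ p * B.natDegree + 1 := by
  refine natDegree_mul_le.trans ?_
  rw [natDegree_comp_X_pow_sub_X]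
  exact Nat.add_le_add_left ((natDegree_C_mul_le _ _).trans natDegree_X_le) _

theorem natDegree_of_monic_add_mul_C_mul_X {n : ℕ} (hpn : ¬p ∣ n) {A B : F[X]} {β : F}
    (hB : B.Monic)
    (ha : (A.comp (X ^ p - X) + B.comp (X ^ p - X) * (C β * X)).Monic)
    (hn : (A.comp (X ^ p - X) + B.comp (X ^ p - X) * (C β * X)).natDegree = n) :
    β = 1 ∧ n = p * B.natDegree + 1 ∧ A.natDegree ≤ B.natDegree := by
  have hp := (Fact.out : p.Prime).two_le
  have hβ : β ≠ 0 := by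
    rintro rfl
    rw [C_0, zero_mul, mul_zero, add_zero, natDegree_comp_X_pow_sub_X] at hn
    exact hpn ⟨_, hn.symm⟩
  have h1 := natDegree_comp_mul_C_mul_X p hB hβ
  have h2 := natDegree_comp_X_pow_sub_X p A
  have hle : A.natDegree ≤ B.natDegree := by
    by_contra! hlt
    have hm : p * (B.natDegree + 1) ≤ p * A.natDegree := Nat.mul_le_mul_left p hlt
    rw [mul_add, mul_one] at hm
    rw [natDegree_add_eq_left_of_natDegree_lt (by omega), h2] at hn
    exact hpn ⟨_, hn.symm⟩
  have hm : p * A.natDegree ≤ p * B.natDegree := Nat.mul_le_mul_left p hle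
  have hlt : (A.comp (X ^ p - X)).natDegree < (B.comp (X ^ p - X) * (C β * X)).natDegree := by
    omega
  rw [natDegree_add_eq_right_of_natDegree_lt hlt, h1] at hn
  rw [Monic, leadingCoeff_add_of_degree_lt (degree_lt_degree hlt),
    leadingCoeff_comp_mul_C_mul_X p hB] at ha
  exact ⟨ha, hn.symm, hle⟩

variable [CharP F p]

theorem X_pow_sub_X_comp : (X ^ p - X : F[X]).comp (X + 1) = X ^ p - X := by
  have : CharP F[X] p := inferInstance
  simp [add_pow_char]

theorem exists_comp_of_comp_X_add_one (f : F[X]) (hf : f.comp (X + 1) = f) :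
    ∃ g : F[X], f = g.comp (X ^ p - X) := by
  have ht := monic_X_pow_sub_X (F := F) p
  have htd := natDegree_X_pow_sub_X (F := F) p
  have hp := (Fact.out : p.Prime).two_le
  induction hn : f.natDegree using Nat.strong_induction_on generalizing f with
  | _ n ih =>
    by_cases hlt : n < p
    · exact ⟨C (f.coeff 0), by rw [C_comp]; exact eq_C_of_comp_X_add_one p hf (hn ▸ hlt)⟩
    have hdiv := modByMonic_add_div f (X ^ p - X)
    set Q := f /ₘ (X ^ p - X) with hQ
    set R := f %ₘ (X ^ p - X) with hR
    have hRdeg : R.degree < (X ^ p - X : F[X]).degree := degree_modByMonic_lt f ht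
    have hcomp : R.comp (X + 1) + (X ^ p - X) * Q.comp (X + 1) = f := by
      conv_rhs => rw [← hf, ← hdiv]
      rw [add_comp, mul_comp, X_pow_sub_X_comp]
    obtain ⟨h1, h2⟩ := div_modByMonic_unique (Q.comp (X + 1)) (R.comp (X + 1)) ht
      ⟨hcomp, by rwa [degree_comp_X_add_one]⟩
    have hRn : R.natDegree < p := by
      have := natDegree_modByMonic_lt f ht (by intro h; rw [h, natDegree_one] at htd; omega)
      rwa [htd] at this
    have hRC := eq_C_of_comp_X_add_one p h2.symm hRn
    obtain ⟨g, hg⟩ := ih Q.natDegree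
      (by rw [hQ, natDegree_divByMonic f ht, htd]; omega) Q h1.symm rfl
    refine ⟨C (R.coeff 0) + X * g, ?_⟩
    rw [add_comp, mul_comp, X_comp, C_comp, ← hg, ← hRC, hdiv]

theorem comp_X_pow_sub_X_comp (f : F[X]) :
    (f.comp (X ^ p - X)).comp (X + 1) = f.comp (X ^ p - X) := by
  rw [comp_assoc, X_pow_sub_X_comp]

theorem translationPairs_subset {n : ℕ} {a b : F[X]} (h : (a, b) ∈ translationPairs F n) :
    ∃ (A B : F[X]) (β : F), a = A.comp (X ^ p - X) + B.comp (X ^ p - X) * (C β * X) ∧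
      b = B.comp (X ^ p - X) ∧ B.Monic ∧ IsCoprime A B := by
  obtain ⟨⟨⟨ha, han, hab, hc⟩, hb⟩, hbX, β, haX⟩ := h
  dsimp only at ha han hab hc hb hbX haX
  obtain ⟨B, rfl⟩ := exists_comp_of_comp_X_add_one p b hbX
  obtain ⟨A, hA⟩ := exists_comp_of_comp_X_add_one p (a - B.comp (X ^ p - X) * (C β * X)) (by
    rw [sub_comp, haX, mul_comp, hbX, mul_comp, C_comp, X_comp]
    ring)
  refine ⟨A, B, β, by rw [← hA]; ring, rfl, ?_, ?_⟩
  · rw [Monic, ← leadingCoeff_comp_X_pow_sub_X p, hb]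
  · rw [← isCoprime_comp_X_pow_sub_X p, ← hA, sub_eq_add_neg, ← mul_neg]
    exact IsCoprime.add_mul_left_left_iff.2 hc

theorem mem_translationPairs {n : ℕ} {A B : F[X]} {β : F} (hB : B.Monic) (hAB : IsCoprime A B)
    (hmonic : (A.comp (X ^ p - X) + B.comp (X ^ p - X) * (C β * X)).Monic)
    (hn : (A.comp (X ^ p - X) + B.comp (X ^ p - X) * (C β * X)).natDegree = n)
    (hBn : p * B.natDegree < n) :
    (A.comp (X ^ p - X) + B.comp (X ^ p - X) * (C β * X), B.comp (X ^ p - X)) ∈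
      translationPairs F n := by
  refine ⟨⟨⟨hmonic, hn, ?_, ?_⟩, ?_⟩, comp_X_pow_sub_X_comp p B, β, ?_⟩
  · refine degree_lt_degree ?_
    dsimp only
    rwa [hn, natDegree_comp_X_pow_sub_X]
  · exact IsCoprime.add_mul_left_left_iff.2 ((isCoprime_comp_X_pow_sub_X p).2 hAB)
  · dsimp only
    rw [Monic, leadingCoeff_comp_X_pow_sub_X, hB]
  · dsimp only
    rw [add_comp, mul_comp, comp_X_pow_sub_X_comp, comp_X_pow_sub_X_comp, mul_comp, C_comp, X_comp]
    ring

theorem eq_of_add_mul_C_mul_X_eq {A A' B : F[X]} {β β' : F} (hB : B.Monic)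
    (h : A.comp (X ^ p - X) + B.comp (X ^ p - X) * (C β * X) =
      A'.comp (X ^ p - X) + B.comp (X ^ p - X) * (C β' * X)) : A = A' ∧ β = β' := by
  have h1 := congrArg (fun f : F[X] => f.comp (X + 1)) h
  simp only [add_comp, mul_comp, comp_X_pow_sub_X_comp, C_comp, X_comp] at h1
  have hB0 : B.comp (X ^ p - X) ≠ 0 := by
    rw [← leadingCoeff_ne_zero, leadingCoeff_comp_X_pow_sub_X, hB]
    exact one_ne_zero
  have h2 : B.comp (X ^ p - X) * C β = B.comp (X ^ p - X) * C β' := by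
    linear_combination h1 - h
  obtain rfl := C_injective (mul_left_cancel₀ hB0 h2)
  exact ⟨comp_X_pow_sub_X_injective p (add_right_cancel h), rfl⟩

theorem card_translationPairs_mul (m : ℕ) :
    Nat.card (translationPairs F (p * m)) = Nat.card F * Nat.card (monicPairs F m) := by
  have hp := (Fact.out : p.Prime).two_le
  rw [← Nat.card_prod]
  symm
  let φ : F × monicPairs F m → translationPairs F (p * m) := fun x =>
    ⟨(x.2.1.1.comp (X ^ p - X) + x.2.1.2.comp (X ^ p - X) * (C x.1 * X),
      x.2.1.2.comp (X ^ p - X)), by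
      obtain ⟨β, ⟨⟨A, B⟩, ⟨hA, hAm, hBA, hc⟩, hB⟩⟩ := x
      dsimp only at hA hAm hBA hc hB ⊢
      have hBm : B.natDegree < m := hAm ▸ natDegree_lt_natDegree hB.ne_zero hBA
      have hBm' : p * (B.natDegree + 1) ≤ p * m := Nat.mul_le_mul_left p hBm
      rw [mul_add, mul_one] at hBm'
      have hlt : (B.comp (X ^ p - X) * (C β * X)).natDegree < (A.comp (X ^ p - X)).natDegree := by
        rw [natDegree_comp_X_pow_sub_X, hAm]
        exact (natDegree_comp_mul_C_mul_X_le p B β).trans_lt (by omega)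
      refine mem_translationPairs p hB hc ?_ ?_ (by omega)
      · rw [Monic, leadingCoeff_add_of_degree_lt' (degree_lt_degree hlt),
          leadingCoeff_comp_X_pow_sub_X, hA]
      · rw [natDegree_add_eq_left_of_natDegree_lt hlt, natDegree_comp_X_pow_sub_X, hAm]⟩
  refine Nat.card_eq_of_bijective φ ⟨?_, ?_⟩
  · rintro ⟨β, ⟨⟨A, B⟩, h, hB⟩⟩ ⟨β', ⟨⟨A', B'⟩, h', hB'⟩⟩ heq
    obtain rfl : B = B' := comp_X_pow_sub_X_injective p (congrArg (fun x => x.1.2) heq)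
    obtain ⟨rfl, rfl⟩ := eq_of_add_mul_C_mul_X_eq p hB (congrArg (fun x => x.1.1) heq)
    rfl
  · rintro ⟨⟨a, b⟩, hx⟩
    obtain ⟨A, B, β, rfl, rfl, hB, hc⟩ := translationPairs_subset p hx
    obtain ⟨⟨ha, han, hba, -⟩, hb⟩ := hx.1
    dsimp only at ha han hba hb
    have hBn := natDegree_lt_natDegree hb.ne_zero hba
    rw [han, natDegree_comp_X_pow_sub_X] at hBn
    have hBm : B.natDegree < m := lt_of_mul_lt_mul_left hBn (Nat.zero_le p)
    have hBm' : p * (B.natDegree + 1) ≤ p * m := Nat.mul_le_mul_left p hBm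
    rw [mul_add, mul_one] at hBm'
    have hlt : (B.comp (X ^ p - X) * (C β * X)).natDegree <
        (A.comp (X ^ p - X) + B.comp (X ^ p - X) * (C β * X)).natDegree := by
      rw [han]
      exact (natDegree_comp_mul_C_mul_X_le p B β).trans_lt (by omega)
    have hA := leadingCoeff_sub_of_degree_lt (degree_lt_degree hlt)
    have hAn := natDegree_sub_eq_left_of_natDegree_lt hlt
    rw [add_sub_cancel_right, leadingCoeff_comp_X_pow_sub_X, ha] at hA
    rw [add_sub_cancel_right, natDegree_comp_X_pow_sub_X, han] at hAn
    replace hAn := Nat.eq_of_mul_eq_mul_left (by omega) hAn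
    exact ⟨(β, ⟨(A, B), ⟨hA, hAn, degree_lt_degree (hAn ▸ hBm), hc⟩, hB⟩), rfl⟩

theorem translationPairs_eq_empty {n : ℕ} (hpn : ¬p ∣ n) (hn : n % p ≠ 1) :
    translationPairs F n = ∅ := by
  have hp := (Fact.out : p.Prime).two_le
  refine Set.eq_empty_of_forall_notMem ?_
  rintro ⟨a, b⟩ hx
  obtain ⟨A, B, β, rfl, rfl, hB, hc⟩ := translationPairs_subset p hx
  obtain ⟨⟨ha, han, -⟩, -⟩ := hx.1
  dsimp only at ha han
  have h := (natDegree_of_monic_add_mul_C_mul_X p hpn hB ha han).2.1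
  rw [h, Nat.mul_add_mod, Nat.mod_eq_of_lt (by omega)] at hn
  exact hn rfl

theorem card_translationPairs_mul_add_one (d : ℕ) :
    Nat.card (translationPairs F (p * d + 1)) = Nat.card (integralPairs F d) := by
  have hp := (Fact.out : p.Prime).two_le
  have hpn : ¬p ∣ p * d + 1 := by
    rw [Nat.dvd_add_right (dvd_mul_right p d)]
    exact (Fact.out : p.Prime).not_dvd_one
  symm
  let φ : integralPairs F d → translationPairs F (p * d + 1) := fun x =>
    ⟨(x.1.1.comp (X ^ p - X) + x.1.2.comp (X ^ p - X) * (C 1 * X), x.1.2.comp (X ^ p - X)), by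
      obtain ⟨⟨A, B⟩, hB, hBd, hAB, hc⟩ := x
      dsimp only at hB hBd hAB hc ⊢
      have hle := natDegree_le_natDegree hAB
      have hm : p * A.natDegree ≤ p * B.natDegree := Nat.mul_le_mul_left p hle
      have hlt : (A.comp (X ^ p - X)).natDegree <
          (B.comp (X ^ p - X) * (C 1 * X)).natDegree := by
        rw [natDegree_comp_X_pow_sub_X, natDegree_comp_mul_C_mul_X p hB one_ne_zero]
        omega
      refine mem_translationPairs p hB hc ?_ ?_ (by rw [hBd]; omega)
      · rw [Monic, leadingCoeff_add_of_degree_lt (degree_lt_degree hlt),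
          leadingCoeff_comp_mul_C_mul_X p hB]
      · rw [natDegree_add_eq_right_of_natDegree_lt hlt,
          natDegree_comp_mul_C_mul_X p hB one_ne_zero, hBd]⟩
  refine Nat.card_eq_of_bijective φ ⟨?_, ?_⟩
  · rintro ⟨⟨A, B⟩, hB, h⟩ ⟨⟨A', B'⟩, hB', h'⟩ heq
    obtain rfl : B = B' := comp_X_pow_sub_X_injective p (congrArg (fun x => x.1.2) heq)
    obtain ⟨rfl, -⟩ := eq_of_add_mul_C_mul_X_eq p hB (congrArg (fun x => x.1.1) heq)
    rfl
  · rintro ⟨⟨a, b⟩, hx⟩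
    obtain ⟨A, B, β, rfl, rfl, hB, hc⟩ := translationPairs_subset p hx
    obtain ⟨⟨ha, han, -⟩, -⟩ := hx.1
    dsimp only at ha han
    obtain ⟨rfl, h1, h2⟩ := natDegree_of_monic_add_mul_C_mul_X p hpn hB ha han
    have hBd : B.natDegree = d := Nat.eq_of_mul_eq_mul_left (by omega) (Nat.succ.inj h1.symm)
    refine ⟨⟨(A, B), hB, hBd, ?_, hc⟩, rfl⟩
    dsimp only
    rw [degree_eq_natDegree hB.ne_zero]
    exact natDegree_le_iff_degree_le.1 h2

end Translation

section FixedFields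

variable {F : Type*} [Field F] {n : ℕ}

theorem comp_mem_monicPairs {a b : F[X]} (h : (a, b) ∈ monicPairs F n) :
    (a.comp (X + 1), b.comp (X + 1)) ∈ monicPairs F n := by
  obtain ⟨⟨ha, han, hba, hc⟩, hb⟩ := h
  dsimp only at ha han hba hc hb
  refine ⟨⟨ha.comp_X_add_C 1, ?_, ?_, hc.map (compRingHom (X + 1))⟩, hb.comp_X_add_C 1⟩
  · rw [← han]
    exact natDegree_eq_of_degree_eq (degree_comp_X_add_one a)
  · dsimp only
    rwa [degree_comp_X_add_one, degree_comp_X_add_one]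

theorem add_mul_mem_monicPairs {a b : F[X]} (h : (a, b) ∈ monicPairs F n) (β : F) :
    (a + C β * b, b) ∈ monicPairs F n := by
  obtain ⟨⟨ha, han, hba, hc⟩, hb⟩ := h
  dsimp only at ha han hba hc hb
  have hlt : (C β * b).degree < a.degree := by
    refine lt_of_le_of_lt ?_ hba
    rw [mul_comm]
    exact (degree_mul_le _ _).trans (add_le_of_nonpos_right degree_C_le)
  refine ⟨⟨ha.add_of_left hlt, ?_, ?_, IsCoprime.add_mul_right_left_iff.2 hc⟩, hb⟩
  · dsimp only
    rw [natDegree_add_eq_left_of_degree_lt hlt, han]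
  · dsimp only
    rwa [degree_add_eq_left_of_degree_lt hlt]

theorem mem_translationPairs_iff (hn : 1 ≤ n) {σ : RatFunc F →ₐ[F] RatFunc F}
    (hσ : σ RatFunc.X = RatFunc.X + 1) {a b : F[X]} :
    (a, b) ∈ translationPairs F n ↔
      (a, b) ∈ monicPairs F n ∧ (quotientField (a, b)).map σ = quotientField (a, b) := by
  refine and_congr_right fun h => ?_
  rw [map_quotientField σ (X + 1) (by simpa using hσ), eq_comm (b := quotientField (a, b)),
    quotientField_eq_iff hn h (comp_mem_monicPairs h), eq_comm (a := b)]

theorem card_mul_card_fixed (hn : 1 ≤ n) {σ : RatFunc F →ₐ[F] RatFunc F}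
    (hσ : σ RatFunc.X = RatFunc.X + 1) :
    Nat.card F * Nat.card {E : IntermediateField F (RatFunc F) //
      Module.finrank E (RatFunc F) = n ∧ E.map σ = E} = Nat.card (translationPairs F n) := by
  rw [← Nat.card_prod]
  choose x hx hxE using fun E : {E : IntermediateField F (RatFunc F) //
    Module.finrank E (RatFunc F) = n ∧ E.map σ = E} => exists_eq_quotientField hn E.1 E.2.1
  have hfield : ∀ β E, quotientField ((x E).1 + C β * (x E).2, (x E).2) = E.1 := fun β E =>
    (quotientField_add_mul (hx E).2.ne_zero β).trans (hxE E)
  refine Nat.card_eq_of_bijective (fun y => ⟨((x y.2).1 + C y.1 * (x y.2).2, (x y.2).2),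
    (mem_translationPairs_iff hn hσ).2 ⟨add_mul_mem_monicPairs (hx y.2) y.1, ?_⟩⟩) ⟨?_, ?_⟩
  · rw [hfield, y.2.2.2]
  · rintro ⟨β, E⟩ ⟨β', E'⟩ heq
    replace heq := congrArg Subtype.val heq
    dsimp only at heq
    obtain rfl : E = E' := Subtype.ext (by rw [← hfield β E, heq, hfield β' E'])
    have h1 := mul_right_cancel₀ (hx E).2.ne_zero (add_left_cancel (congrArg Prod.fst heq))
    rw [C_injective h1]
  · rintro ⟨⟨a, b⟩, hab⟩
    obtain ⟨hm, hfix⟩ := (mem_translationPairs_iff hn hσ).1 hab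
    let E : {E : IntermediateField F (RatFunc F) //
      Module.finrank E (RatFunc F) = n ∧ E.map σ = E} :=
      ⟨quotientField (a, b), finrank_quotientField hm, hfix⟩
    obtain ⟨h1, β, h2⟩ := (quotientField_eq_iff hn (hx E) hm).1 (hxE E)
    exact ⟨(β, E), Subtype.ext (Prod.ext h2.symm h1)⟩

end FixedFields

/-- The number of intermediate fields of `F_q(X)/F_q` of codegree `n` fixed by the
automorphism `X ↦ X + 1`, where `p` is the characteristic of `F_q`. -/
theorem fix_translation (q n p : ℕ) (hq : IsPrimePow q) (hn : 1 ≤ n)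
    (F : Type*) [Field F] [Fintype F] (hF : Fintype.card F = q) [CharP F p]
    (σ : RatFunc F ≃ₐ[F] RatFunc F)
    (hσ : σ RatFunc.X = RatFunc.X + 1) :
    Nat.card {E : IntermediateField F (RatFunc F) //
        Module.finrank E (RatFunc F) = n ∧ E.map σ.toAlgHom = E} =
      if p ∣ n then q ^ (2 * (n / p) - 1)
      else if n = 1 then 1
      else if n % p = 1 then q ^ (2 * ((n - 1) / p) - 1) * (q - 1)
      else 0 := by
  have hp : p.Prime := CharP.char_is_prime F p
  have : Fact p.Prime := ⟨hp⟩
  have hcard := card_mul_card_fixed (σ := σ.toAlgHom) hn hσ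
  rw [Nat.card_eq_fintype_card (α := F), hF] at hcard
  have hFq : Nat.card F = q := by rw [Nat.card_eq_fintype_card, hF]
  have hq0 : 0 < q := hq.pos
  refine Nat.eq_of_mul_eq_mul_left hq0 (hcard.trans ?_)
  split_ifs with h1 h2 h3
  · obtain ⟨m, rfl⟩ := h1
    obtain ⟨m, rfl⟩ : ∃ k, m = k + 1 := Nat.exists_eq_succ_of_ne_zero (by rintro rfl; simp at hn)
    rw [card_translationPairs_mul, card_monicPairs, hFq,
      Nat.mul_div_cancel_left _ hp.pos]
    rfl
  · have := card_translationPairs_mul_add_one (F := F) p 0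
    rw [mul_zero, zero_add, card_integralPairs, card_properPairs_zero, hFq] at this
    rw [h2, this]
  · have hdm := Nat.div_add_mod n p
    rw [h3] at hdm
    obtain ⟨d, hd⟩ : ∃ d, n / p = d + 1 :=
      Nat.exists_eq_succ_of_ne_zero (by intro h; rw [h] at hdm; omega)
    rw [hd] at hdm
    rw [← hdm, card_translationPairs_mul_add_one, card_integralPairs, card_properPairs (by omega),
      card_monicPairs, hFq, Nat.add_sub_cancel, Nat.mul_div_cancel_left _ hp.pos,
      show 2 * (d + 1) - 1 = 2 * d + 1 by omega]
    ring
  · rw [translationPairs_eq_empty p h1 h3]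
    simp
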